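/- Let P ⊆ ℝ³ be a 3-dimensional reflexive canonical lattice polytope with interior lattice point p, let V be the normalized volume of P, and let T be a fine central unimodular triangulation of P. Then T contains exactly V tetrahedra (3-simplices), exactly (3/2)·V triangles (2-simplices) containing p, and exactly V/2 + 2 edges (1-simplices) containing p. (By duality these numbers are the entries f₀, f₁, f₂ of the f-vector of the K3 polytope dual to T.) -/

import Mathlib

open Set MeasureTheory

noncomputable section

/-- Points of `ℝ³` with integer coordinates. -/
def latticePts : Set (Fin 3 → ℝ) := {x | ∀ i, ∃ n : ℤ, x i = (n : ℝ)}

/-- The point `(1,1,1)`. -/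
def pOne : Fin 3 → ℝ := ![1, 1, 1]

/-- The tetrahedron `4Δ₃ = conv{(0,0,0),(4,0,0),(0,4,0),(0,0,4)}`. -/
def Delta4 : Set (Fin 3 → ℝ) :=
  convexHull ℝ {![0, 0, 0], ![4, 0, 0], ![0, 4, 0], ![0, 0, 4]}

/-- A subpolytope of `4Δ₃`: a lattice polytope `P ⊆ 4Δ₃` with `P = conv(P ∩ ℤ³)`. -/
def IsSubpolytope (P : Set (Fin 3 → ℝ)) : Prop :=
  P ⊆ Delta4 ∧ P = convexHull ℝ (P ∩ latticePts)

/-- A canonical subpolytope of `4Δ₃`: a subpolytope with `(1,1,1)` in its interior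
(this forces it to be `3`-dimensional). -/
def IsCanonicalSub (P : Set (Fin 3 → ℝ)) : Prop :=
  IsSubpolytope P ∧ pOne ∈ interior P

/-- The standard inner product on `ℝⁿ`. -/
def dotp {n : ℕ} (a x : Fin n → ℝ) : ℝ := ∑ i, a i * x i

/-- Equivalence of subsets of `ℝ³` under the group of affine symmetries of `4Δ₃`. -/
def SymEquiv (P Q : Set (Fin 3 → ℝ)) : Prop :=
  ∃ g : (Fin 3 → ℝ) ≃ᵃ[ℝ] (Fin 3 → ℝ), g '' Delta4 = Delta4 ∧ g '' P = Q

/-- `F` is a facet of `P`: an exposed face of dimension `2`. -/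
def IsFacetOf (F P : Set (Fin 3 → ℝ)) : Prop :=
  ∃ (a : Fin 3 → ℝ) (b : ℝ),
    (∀ x ∈ P, b ≤ dotp a x) ∧ F = P ∩ {x | dotp a x = b} ∧
    Module.finrank ℝ (affineSpan ℝ F).direction = 2

/-- `P` (canonical, with interior lattice point `p`) is reflexive: every facet lies on an
integral hyperplane at lattice distance one from `p`. -/
def IsReflexive (P : Set (Fin 3 → ℝ)) (p : Fin 3 → ℝ) : Prop :=
  ∀ F, IsFacetOf F P →
    ∃ (a : Fin 3 → ℤ) (b : ℤ),
      (∀ x ∈ F, dotp (fun i => (a i : ℝ)) x = (b : ℝ)) ∧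
      (∀ x ∈ P, (b : ℝ) ≤ dotp (fun i => (a i : ℝ)) x) ∧
      dotp (fun i => (a i : ℝ)) p = (b : ℝ) + 1

/-- `T` is a triangulation of `P`: a finite collection of simplices (given by their
vertex sets, which are affinely independent sets of lattice points of `P`) whose union
is `P`, closed under taking faces, any two meeting in a common face. -/
def IsTriangulationOf (P : Set (Fin 3 → ℝ)) (T : Set (Finset (Fin 3 → ℝ))) : Prop :=
  T.Finite ∧
  (∀ S ∈ T, (S : Set (Fin 3 → ℝ)) ⊆ P ∩ latticePts ∧
    AffineIndependent ℝ (fun v : (S : Set (Fin 3 → ℝ)) => (v : Fin 3 → ℝ))) ∧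
  (⋃ S ∈ T, convexHull ℝ (S : Set (Fin 3 → ℝ))) = P ∧
  (∀ S ∈ T, ∀ S' : Finset (Fin 3 → ℝ), S' ⊆ S → S' ∈ T) ∧
  (∀ S ∈ T, ∀ S' ∈ T, ∃ F : Finset (Fin 3 → ℝ), F ∈ T ∧ F ⊆ S ∧ F ⊆ S' ∧
    convexHull ℝ (S : Set (Fin 3 → ℝ)) ∩ convexHull ℝ (S' : Set (Fin 3 → ℝ)) =
      convexHull ℝ (F : Set (Fin 3 → ℝ)))

/-- `T` is central: every `3`-simplex of `T` contains `p`. -/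
def IsCentral (p : Fin 3 → ℝ) (T : Set (Finset (Fin 3 → ℝ))) : Prop :=
  ∀ S ∈ T, S.card = 4 → p ∈ convexHull ℝ (S : Set (Fin 3 → ℝ))

/-- `T` is unimodular: every `3`-simplex of `T` has Euclidean volume `1/6`. -/
def IsUnimodular (T : Set (Finset (Fin 3 → ℝ))) : Prop :=
  ∀ S ∈ T, S.card = 4 →
    volume (convexHull ℝ (S : Set (Fin 3 → ℝ))) = ENNReal.ofReal (1 / 6)

/-- `T` is fine: every lattice point of `P` is a vertex of a simplex of `T`. -/
def IsFine (P : Set (Fin 3 → ℝ)) (T : Set (Finset (Fin 3 → ℝ))) : Prop :=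
  ∀ x ∈ P ∩ latticePts, ∃ S ∈ T, x ∈ S

/-- The weight function `w` induces the triangulation `T` of `P`
(it is a regularity certificate for `T`). -/
def Induces (P : Set (Fin 3 → ℝ)) (T : Set (Finset (Fin 3 → ℝ))) (w : (Fin 3 → ℝ) → ℝ) :
    Prop :=
  ∀ S ∈ T, S.card = 4 → ∃ ℓ : (Fin 3 → ℝ) →ᵃ[ℝ] ℝ,
    (∀ v ∈ S, ℓ v = w v) ∧ ∀ v ∈ P ∩ latticePts, v ∉ S → ℓ v < w v

/-- `T` is a regular triangulation of `P`. -/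
def IsRegularTriang (P : Set (Fin 3 → ℝ)) (T : Set (Finset (Fin 3 → ℝ))) : Prop :=
  ∃ w : (Fin 3 → ℝ) → ℝ, Induces P T w

/-- A canonical lattice polytope in `ℝ³` with interior lattice point `p`. -/
def IsCanonicalPoly (P : Set (Fin 3 → ℝ)) (p : Fin 3 → ℝ) : Prop :=
  (∃ F : Set (Fin 3 → ℝ), F.Finite ∧ F ⊆ latticePts ∧ P = convexHull ℝ F) ∧
  p ∈ latticePts ∧ interior P ∩ latticePts = {p}

section Coordinates

open Filter Topology

variable {E : Type*} [NormedAddCommGroup E] [NormedSpace ℝ E]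

/-- `c` is a system of barycentric coordinates for the vertex set `S`. -/
def IsCoords (S : Finset E) (c : E → E →ᵃ[ℝ] ℝ) : Prop :=
  ∀ v ∈ S, c v v = 1 ∧ ∀ w ∈ S, v ≠ w → c v w = 0

lemma exists_isCoords [FiniteDimensional ℝ E] (S : Finset E)
    (hS : AffineIndependent ℝ (fun v : (S : Set E) => (v : E))) :
    ∃ c : E → E →ᵃ[ℝ] ℝ, IsCoords S c ∧
      (S.card = Module.finrank ℝ E + 1 → ∀ x, (∀ v ∈ S, 0 ≤ c v x) →
        x ∈ convexHull ℝ (S : Set E)) := by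
  classical
  obtain ⟨t, hst, hti, htop⟩ := exists_subset_affineIndependent_affineSpan_eq_top hS
  let b : AffineBasis t ℝ E := ⟨fun v => (v : E), hti, by simpa using htop⟩
  have hb : ∀ v : t, b v = (v : E) := fun v => rfl
  have hrange : Set.range b = t := by
    ext x
    simp [hb]
  refine ⟨fun v => if h : v ∈ t then b.coord ⟨v, h⟩ else 0, fun v hv => ⟨?_, fun w hw hvw => ?_⟩,
    fun hcard x hx => ?_⟩
  · have hvt := hst hv
    simpa [hvt, hb] using b.coord_apply_eq ⟨v, hvt⟩
  · have hvt := hst hv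
    have hwt := hst hw
    simpa [hvt, hb] using b.coord_apply_ne (i := ⟨v, hvt⟩) (j := ⟨w, hwt⟩) (by simpa using hvw)
  · have : Finite t := finite_of_fin_dim_affineIndependent ℝ hti
    have : Fintype t := Fintype.ofFinite t
    have hct : t.toFinset.card = Module.finrank ℝ E + 1 := by
      rw [Set.toFinset_card]
      exact hti.affineSpan_eq_top_iff_card_eq_finrank_add_one.1 (by simpa using htop)
    have hSt : S = t.toFinset :=
      Finset.eq_of_subset_of_card_le (fun v hv => by simpa using hst hv) (by omega)
    have hSt' : (S : Set E) = t := by simp [hSt]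
    rw [hSt', ← hrange, b.convexHull_eq_nonneg_coord]
    rintro ⟨v, hv⟩
    have := hx v (by simpa [hSt] using hv)
    simpa [hv] using this

lemma AffineMap.apply_add_smul (f : E →ᵃ[ℝ] ℝ) (x q : E) (t : ℝ) :
    f (x + t • q) = f x + t * f.linear q := by
  have := f.map_vadd x (t • q)
  simp only [vadd_eq_add, map_smul, smul_eq_mul] at this
  rw [add_comm x, this, add_comm]

lemma AffineMap.eq_zero_of_mem_convexHull (f : E →ᵃ[ℝ] ℝ) {s : Set E} (hs : ∀ v ∈ s, f v = 0)
    {x : E} (hx : x ∈ convexHull ℝ s) : f x = 0 := by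
  have h : s ⊆ f ⁻¹' {0} := fun v hv => hs v hv
  exact convexHull_min h ((convex_singleton (0 : ℝ)).affine_preimage f) hx

lemma AffineMap.nonneg_of_mem_convexHull (f : E →ᵃ[ℝ] ℝ) {s : Set E} (hs : ∀ v ∈ s, 0 ≤ f v)
    {x : E} (hx : x ∈ convexHull ℝ s) : 0 ≤ f x := by
  have h : s ⊆ f ⁻¹' (Set.Ici 0) := fun v hv => hs v hv
  exact convexHull_min h ((convex_Ici (0 : ℝ)).affine_preimage f) hx

lemma IsCoords.nonneg {S : Finset E} {c : E → E →ᵃ[ℝ] ℝ} (hc : IsCoords S c) {v : E} (hv : v ∈ S)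
    {x : E} (hx : x ∈ convexHull ℝ (S : Set E)) : 0 ≤ c v x := by
  refine (c v).nonneg_of_mem_convexHull (fun w hw => ?_) hx
  by_cases h : v = w
  · rw [← h, (hc v hv).1]
    exact zero_le_one
  · exact ((hc v hv).2 w hw h).ge

lemma IsCoords.eq_zero {S F : Finset E} {c : E → E →ᵃ[ℝ] ℝ} (hc : IsCoords S c) (hFS : F ⊆ S)
    {v : E} (hv : v ∈ S) (hvF : v ∉ F) {x : E} (hx : x ∈ convexHull ℝ (F : Set E)) :
    c v x = 0 :=
  (c v).eq_zero_of_mem_convexHull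
    (fun w hw => (hc v hv).2 w (hFS hw) (by rintro rfl; exact hvF hw)) hx

/-- A face whose convex hull contains a point with positive coordinates is the whole simplex. -/
lemma IsCoords.eq_of_pos {S F : Finset E} {c : E → E →ᵃ[ℝ] ℝ} (hc : IsCoords S c) (hFS : F ⊆ S)
    {x : E} (hx : x ∈ convexHull ℝ (F : Set E)) (hpos : ∀ v ∈ S, 0 < c v x) : F = S := by
  refine Finset.Subset.antisymm hFS fun v hv => ?_
  by_contra hvF
  exact (hpos v hv).ne' (hc.eq_zero hFS hv hvF hx)

/-- Near a vertex `p` of a simplex there is a point of its relative interior. -/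
lemma exists_mem_convexHull_coords_pos {F : Finset E} {p : E}
    (hp : p ∈ F) {U : Set E} (hU : U ∈ 𝓝 p) :
    ∃ x ∈ U, x ∈ convexHull ℝ (F : Set E) ∧ ∀ d : E → E →ᵃ[ℝ] ℝ, IsCoords F d →
      ∀ v ∈ F, 0 < d v x := by
  have hcard : (0 : ℝ) < F.card := by exact_mod_cast Finset.card_pos.2 ⟨p, hp⟩
  set m : E := ∑ w ∈ F, (F.card : ℝ)⁻¹ • w with hm
  have hsum : ∑ _w ∈ F, (F.card : ℝ)⁻¹ = 1 := by
    rw [Finset.sum_const, nsmul_eq_mul, mul_inv_cancel₀ hcard.ne']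
  have hmF : m ∈ convexHull ℝ (F : Set E) :=
    (convex_convexHull ℝ _).sum_mem (fun _ _ => by positivity) hsum
      (fun w hw => subset_convexHull ℝ _ hw)
  have hmpos : ∀ d : E → E →ᵃ[ℝ] ℝ, IsCoords F d → ∀ v ∈ F, 0 < d v m := by
    intro d hd v hv
    have hdm : d v m = ∑ w ∈ F, (F.card : ℝ)⁻¹ * d v w := by
      have h := Finset.map_affineCombination F id (fun _ => (F.card : ℝ)⁻¹) hsum (d v)
      rw [Finset.affineCombination_eq_linear_combination _ _ _ hsum,
        Finset.affineCombination_eq_linear_combination _ _ _ hsum] at h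
      simpa using h
    rw [hdm, Finset.sum_eq_single v]
    · rw [(hd v hv).1]
      positivity
    · intro w hw hwv
      rw [(hd v hv).2 w hw hwv.symm, mul_zero]
    · exact fun h => absurd hv h
  have hcont : Tendsto (fun t : ℝ => p + t • (m - p)) (𝓝[>] 0) (𝓝 p) := by
    have : Continuous fun t : ℝ => p + t • (m - p) := by fun_prop
    simpa using (this.tendsto 0).mono_left nhdsWithin_le_nhds
  obtain ⟨t, htU, ht⟩ := ((hcont.eventually hU).and
    (Ioo_mem_nhdsGT (zero_lt_one (α := ℝ)))).exists
  have hpF : p ∈ convexHull ℝ (F : Set E) := subset_convexHull ℝ _ hp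
  refine ⟨_, htU, ?_, fun d hd v hv => ?_⟩
  · exact (convex_convexHull ℝ _).add_smul_sub_mem hpF hmF ⟨ht.1.le, ht.2.le⟩
  · have h1 : d v (p + t • (m - p)) = (1 - t) * d v p + t * d v m := by
      have h2 := (d v).apply_add_smul p (m - p) 1
      rw [one_smul, add_sub_cancel, one_mul] at h2
      rw [AffineMap.apply_add_smul, h2]
      ring
    rw [h1]
    have := mul_nonneg (sub_nonneg.2 ht.2.le) (hd.nonneg hv hpF)
    have := mul_pos ht.1 (hmpos d hd v hv)
    linarith

end Coordinates

lemma exists_notMem_of_finite_of_ne_top {E : Type*} [AddCommGroup E] [Module ℝ E]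
    {s : Set (Submodule ℝ E)} (hs : s.Finite) (htop : ⊤ ∉ s) : ∃ q : E, ∀ W ∈ s, q ∉ W := by
  by_contra! h
  refine Subspace.biUnion_ne_univ_of_top_notMem (s := hs.toFinset) (by simpa using htop) ?_
  refine Set.eq_univ_of_forall fun q => ?_
  obtain ⟨W, hW, hq⟩ := h q
  exact Set.mem_biUnion (by simpa using hW) hq

lemma vectorSpan_ne_top_of_card_le {E : Type*} [AddCommGroup E] [Module ℝ E]
    (S : Finset E) (hE : 0 < Module.finrank ℝ E) (hS : S.card ≤ Module.finrank ℝ E) :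
    vectorSpan ℝ (S : Set E) ≠ ⊤ := by
  classical
  intro h
  rcases S.eq_empty_or_nonempty with rfl | hne
  · rw [Finset.coe_empty, vectorSpan_empty] at h
    have := finrank_top ℝ E
    rw [← h, finrank_bot] at this
    omega
  · have hpos := hne.card_pos
    have := finrank_vectorSpan_image_finset_le ℝ (id : E → E) S (n := S.card - 1) (by omega)
    rw [Finset.image_id, h, finrank_top] at this
    omega

/-- Double counting of the `k`-element faces through `p`, when each of them lies in exactly one
cell whose remaining vertices are all marked by `m`. -/
lemma card_faces_eq_sum_choose {α : Type*} [DecidableEq α] (C B : Finset (Finset α)) (p : α)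
    (m : Finset α → Finset α) (k j : ℕ) (hm : ∀ S ∈ C, m S ⊆ S.erase p)
    (hpC : ∀ S ∈ C, p ∈ S) (hcard : ∀ S ∈ C, S.card = k + j)
    (hB : ∀ S ∈ C, ∀ F ⊆ S, p ∈ F → F.card = k → F ∈ B)
    (hB' : ∀ F ∈ B, p ∈ F ∧ F.card = k)
    (huniq : ∀ F ∈ B, ∃! S, S ∈ C ∧ F ⊆ S ∧ S \ F ⊆ m S) :
    B.card = ∑ S ∈ C, (m S).card.choose j := by
  classical
  have h1 : ∀ F ∈ B, (C.bipartiteAbove (fun F S => F ⊆ S ∧ S \ F ⊆ m S) F).card = 1 := by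
    intro F hF
    obtain ⟨S, hS, hu⟩ := huniq F hF
    rw [Finset.card_eq_one]
    refine ⟨S, Finset.ext fun S' => ?_⟩
    rw [Finset.mem_bipartiteAbove, Finset.mem_singleton]
    exact ⟨fun h => hu S' h, fun h => h ▸ hS⟩
  have h2 : ∀ S ∈ C, (B.bipartiteBelow (fun F S => F ⊆ S ∧ S \ F ⊆ m S) S).card =
      (m S).card.choose j := by
    intro S hS
    rw [← Finset.card_powersetCard]
    refine Finset.card_bij' (fun F _ => S \ F) (fun G _ => S \ G) ?_ ?_ ?_ ?_
    · intro F hF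
      rw [Finset.mem_bipartiteBelow] at hF
      rw [Finset.mem_powersetCard, Finset.card_sdiff_of_subset hF.2.1, hcard S hS,
        (hB' F hF.1).2]
      exact ⟨hF.2.2, by omega⟩
    · intro G hG
      rw [Finset.mem_powersetCard] at hG
      have hGp := hG.1.trans (hm S hS)
      have hGS := hGp.trans (Finset.erase_subset _ _)
      rw [Finset.mem_bipartiteBelow, Finset.sdiff_sdiff_eq_self hGS]
      refine ⟨hB S hS _ Finset.sdiff_subset ?_ ?_, Finset.sdiff_subset, hG.1⟩
      · exact Finset.mem_sdiff.2 ⟨hpC S hS, fun h => by simpa using hGp h⟩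
      · rw [Finset.card_sdiff_of_subset hGS, hcard S hS, hG.2]
        omega
    · intro F hF
      exact Finset.sdiff_sdiff_eq_self (Finset.mem_bipartiteBelow _ |>.1 hF).2.1
    · intro G hG
      exact Finset.sdiff_sdiff_eq_self
        (((Finset.mem_powersetCard.1 hG).1.trans (hm S hS)).trans (Finset.erase_subset _ _))
  rw [← Finset.sum_congr rfl h2, ← Finset.sum_card_bipartiteAbove_eq_sum_card_bipartiteBelow,
    Finset.sum_congr rfl h1, Finset.card_eq_sum_ones]

section Triangulation

open Filter Topology

variable {P : Set (Fin 3 → ℝ)} {p : Fin 3 → ℝ} {T : Set (Finset (Fin 3 → ℝ))}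

lemma IsTriangulationOf.card_le_four (hT : IsTriangulationOf P T) {S : Finset (Fin 3 → ℝ)}
    (hS : S ∈ T) : S.card ≤ 4 := by
  have h := (hT.2.1 S hS).2.card_le_finrank_succ
  have h' := Submodule.finrank_le
    (vectorSpan ℝ (Set.range (fun v : (S : Set (Fin 3 → ℝ)) => (v : Fin 3 → ℝ))))
  simp only [Finset.coe_sort_coe, Fintype.card_coe, Module.finrank_fin_fun] at h h'
  omega

lemma IsTriangulationOf.mem_of_mem_convexHull (hT : IsTriangulationOf P T)
    {S S' : Finset (Fin 3 → ℝ)} (hS : S ∈ T) (hpS : p ∈ S) (hS' : S' ∈ T)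
    (hp : p ∈ convexHull ℝ (S' : Set (Fin 3 → ℝ))) : p ∈ S' := by
  have hpT : {p} ∈ T := hT.2.2.2.1 S hS _ (by simpa using hpS)
  obtain ⟨F, -, hF, hFS', h⟩ := hT.2.2.2.2 _ hpT _ hS'
  have hpF : p ∈ convexHull ℝ (F : Set (Fin 3 → ℝ)) := by
    rw [← h]
    exact ⟨by simp, hp⟩
  rcases Finset.subset_singleton_iff.1 hF with rfl | rfl
  · simp at hpF
  · simpa using hFS'

/-- Pushing a point of the relative interior of a face `F` in a generic direction `q` leads into
exactly one tetrahedron of the triangulation. -/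
lemma IsTriangulationOf.existsUnique_tetrahedron (hT : IsTriangulationOf P T) (hp : P ∈ 𝓝 p)
    {c : Finset (Fin 3 → ℝ) → (Fin 3 → ℝ) → (Fin 3 → ℝ) →ᵃ[ℝ] ℝ}
    (hc : ∀ S ∈ T, IsCoords S (c S))
    (hc4 : ∀ S ∈ T, S.card = 4 → ∀ x, (∀ v ∈ S, 0 ≤ c S v x) →
      x ∈ convexHull ℝ (S : Set (Fin 3 → ℝ)))
    {q : Fin 3 → ℝ} (hq : ∀ S ∈ T, S.card ≤ 3 → q ∉ vectorSpan ℝ (S : Set (Fin 3 → ℝ)))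
    (hqc : ∀ S ∈ T, S.card = 4 → ∀ v ∈ S, (c S v).linear q ≠ 0)
    {F : Finset (Fin 3 → ℝ)} (hF : F ∈ T) (hpF : p ∈ F) :
    ∃! S, (S ∈ T ∧ S.card = 4) ∧ F ⊆ S ∧ ∀ v ∈ S, v ∉ F → 0 < (c S v).linear q := by
  obtain ⟨x, hxP, hxF, hxpos⟩ := exists_mem_convexHull_coords_pos hpF (interior_mem_nhds.2 hp)
  have hcont : Tendsto (fun t : ℝ => x + t • q) (𝓝[>] 0) (𝓝 x) := by
    have : Continuous fun t : ℝ => x + t • q := by fun_prop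
    simpa using (this.tendsto 0).mono_left nhdsWithin_le_nhds
  have hsub : ∀ S ∈ T, x ∈ convexHull ℝ (S : Set (Fin 3 → ℝ)) → F ⊆ S := by
    intro S hS hxS
    obtain ⟨G, -, hGF, hGS, h⟩ := hT.2.2.2.2 F hF S hS
    have hxG : x ∈ convexHull ℝ (G : Set (Fin 3 → ℝ)) := h ▸ ⟨hxF, hxS⟩
    rwa [← (hc F hF).eq_of_pos hGF hxG (hxpos _ (hc F hF))]
  obtain ⟨S, hS, hfreq⟩ : ∃ S ∈ T, ∃ᶠ t in 𝓝[>] (0 : ℝ),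
      x + t • q ∈ convexHull ℝ (S : Set (Fin 3 → ℝ)) := by
    by_contra! h
    have hev : ∀ᶠ t in 𝓝[>] (0 : ℝ), ∀ S ∈ T,
        x + t • q ∉ convexHull ℝ (S : Set (Fin 3 → ℝ)) :=
      (eventually_all_finite hT.1).2 fun S hS => h S hS
    obtain ⟨t, ht, htP⟩ := (hev.and (hcont.eventually (mem_interior_iff_mem_nhds.1 hxP))).exists
    change x + t • q ∈ P at htP
    rw [← hT.2.2.1] at htP
    simp only [Set.mem_iUnion] at htP
    obtain ⟨S, hS, hx⟩ := htP
    exact ht S hS hx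
  have hxS : x ∈ convexHull ℝ (S : Set (Fin 3 → ℝ)) :=
    (S.finite_toSet.isCompact_convexHull (𝕜 := ℝ)).isClosed.mem_of_frequently_of_tendsto hfreq hcont
  have hFS := hsub S hS hxS
  obtain ⟨t, ht, ht0⟩ := (hfreq.and_eventually self_mem_nhdsWithin).exists
  change 0 < t at ht0
  have hqS : q ∈ vectorSpan ℝ (S : Set (Fin 3 → ℝ)) := by
    have h := vsub_mem_vectorSpan_of_mem_affineSpan_of_mem_affineSpan
      (convexHull_subset_affineSpan (𝕜 := ℝ) _ ht) (convexHull_subset_affineSpan (𝕜 := ℝ) _ hxS)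
    rw [vsub_eq_sub, add_sub_cancel_left] at h
    exact (Submodule.smul_mem_iff _ ht0.ne').1 h
  have hS4 : S.card = 4 := by
    have := hT.card_le_four hS
    by_contra hne
    exact hq S hS (by omega) hqS
  have hpos : ∀ v ∈ S, v ∉ F → 0 < (c S v).linear q := by
    intro v hv hvF
    have h := (hc S hS).nonneg hv ht
    rw [AffineMap.apply_add_smul, (hc S hS).eq_zero hFS hv hvF hxF, zero_add] at h
    exact lt_of_le_of_ne (nonneg_of_mul_nonneg_right h ht0) (hqc S hS hS4 v hv).symm
  have hposev : ∀ S', (S' ∈ T ∧ S'.card = 4) ∧ F ⊆ S' ∧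
      (∀ v ∈ S', v ∉ F → 0 < (c S' v).linear q) →
      ∀ᶠ t in 𝓝[>] (0 : ℝ), ∀ v ∈ S', 0 < c S' v (x + t • q) := by
    rintro S' ⟨⟨hS', -⟩, hFS', hpos⟩
    refine (eventually_all_finset S').2 fun v hv => ?_
    by_cases hvF : v ∈ F
    · have hvx : 0 < c S' v x :=
        hxpos (c S') (fun v hv => ⟨(hc S' hS' v (hFS' hv)).1,
          fun w hw => (hc S' hS' v (hFS' hv)).2 w (hFS' hw)⟩) v hvF
      have := ((c S' v).continuous_of_finiteDimensional.tendsto x).comp hcont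
      exact this.eventually (lt_mem_nhds hvx)
    · filter_upwards [self_mem_nhdsWithin] with t ht
      rw [AffineMap.apply_add_smul, (hc S' hS').eq_zero hFS' hv hvF hxF, zero_add]
      exact mul_pos ht (hpos v hv hvF)
  refine ⟨S, ⟨⟨hS, hS4⟩, hFS, hpos⟩, fun S' hS' => ?_⟩
  obtain ⟨t, h, h'⟩ := ((hposev S ⟨⟨hS, hS4⟩, hFS, hpos⟩).and (hposev S' hS')).exists
  obtain ⟨G, -, hGS, hGS', hG⟩ := hT.2.2.2.2 S hS S' hS'.1.1
  have hxG : x + t • q ∈ convexHull ℝ (G : Set (Fin 3 → ℝ)) := hG ▸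
    ⟨hc4 S hS hS4 _ fun v hv => (h v hv).le,
      hc4 S' hS'.1.1 hS'.1.2 _ fun v hv => (h' v hv).le⟩
  rw [← (hc S hS).eq_of_pos hGS hxG h, ← (hc S' hS'.1.1).eq_of_pos hGS' hxG h']

lemma IsTriangulationOf.volume_eq (hT : IsTriangulationOf P T) (huni : IsUnimodular T) :
    volume P = ({S | S ∈ T ∧ S.card = 4}.ncard : ENNReal) * ENNReal.ofReal (1 / 6) := by
  classical
  have hnull : ∀ S : Finset (Fin 3 → ℝ), S.card ≤ 3 →
      volume (convexHull ℝ (S : Set (Fin 3 → ℝ))) = 0 := by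
    intro S hS
    refine measure_mono_null (convexHull_subset_affineSpan (𝕜 := ℝ) _)
      (Measure.addHaar_affineSubspace _ _ fun h => ?_)
    refine vectorSpan_ne_top_of_card_le S (by simp) (by simpa using hS) ?_
    rw [← direction_affineSpan, h, AffineSubspace.direction_top]
  have hdisj : Set.Pairwise (hT.1.toFinset : Set (Finset (Fin 3 → ℝ)))
      (Function.onFun (AEDisjoint volume) fun S => convexHull ℝ (S : Set (Fin 3 → ℝ))) := by
    intro S hS S' hS' hne
    rw [Finset.mem_coe, Set.Finite.mem_toFinset] at hS hS'
    obtain ⟨G, -, hGS, hGS', hG⟩ := hT.2.2.2.2 S hS S' hS'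
    change volume (_ ∩ _) = 0
    rw [hG]
    refine hnull G ?_
    by_contra! hG4
    have h4 := hT.card_le_four hS
    have h4' := hT.card_le_four hS'
    exact hne ((Finset.eq_of_subset_of_card_le hGS (by omega)).symm.trans
      (Finset.eq_of_subset_of_card_le hGS' (by omega)))
  have hset : {S | S ∈ T ∧ S.card = 4} = ↑(hT.1.toFinset.filter fun S => S.card = 4) := by
    ext S
    simp
  have hunion : P = ⋃ S ∈ hT.1.toFinset, convexHull ℝ (S : Set (Fin 3 → ℝ)) := by
    simpa using hT.2.2.1.symm
  rw [hset, Set.ncard_coe_finset, ← nsmul_eq_mul, ← Finset.sum_const, Finset.sum_filter,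
    congrArg volume hunion, measure_biUnion_finset₀ hdisj fun S _ =>
      (S.finite_toSet.isCompact_convexHull (𝕜 := ℝ)).measurableSet.nullMeasurableSet]
  refine Finset.sum_congr rfl fun S hS => ?_
  rw [Set.Finite.mem_toFinset] at hS
  split_ifs with h
  · exact huni S hS h
  · have := hT.card_le_four hS
    exact hnull S (by omega)

lemma IsTriangulationOf.ncard_tetrahedra (hT : IsTriangulationOf P T) (huni : IsUnimodular T) {V : ℕ}
    (hV : volume P * 6 = (V : ENNReal)) : {S | S ∈ T ∧ S.card = 4}.ncard = V := by
  have h6 : ENNReal.ofReal (1 / 6) * 6 = 1 := by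
    rw [← ENNReal.ofReal_ofNat 6, ← ENNReal.ofReal_mul (by norm_num)]
    norm_num
  rw [hT.volume_eq huni, mul_assoc, h6, mul_one] at hV
  exact_mod_cast hV

/-- There is a direction that is generic with respect to all simplices of a triangulation. -/
lemma IsTriangulationOf.exists_generic (hT : IsTriangulationOf P T)
    {c : Finset (Fin 3 → ℝ) → (Fin 3 → ℝ) → (Fin 3 → ℝ) →ᵃ[ℝ] ℝ}
    (hc : ∀ S ∈ T, IsCoords S (c S)) :
    ∃ q : Fin 3 → ℝ, (∀ S ∈ T, S.card ≤ 3 → q ∉ vectorSpan ℝ (S : Set (Fin 3 → ℝ))) ∧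
      ∀ S ∈ T, S.card = 4 → ∀ v ∈ S, (c S v).linear q ≠ 0 := by
  have hfin : ((fun S : Finset (Fin 3 → ℝ) => vectorSpan ℝ (S : Set (Fin 3 → ℝ))) ''
        {S | S ∈ T ∧ S.card ≤ 3} ∪
      ⋃ S ∈ {S | S ∈ T ∧ S.card = 4},
        (fun v => LinearMap.ker (c S v).linear) '' (S : Set (Fin 3 → ℝ))).Finite :=
    ((hT.1.subset fun S hS => hS.1).image _).union
      ((hT.1.subset fun S hS => hS.1).biUnion fun S _ => S.finite_toSet.image _)
  obtain ⟨q, hq⟩ := exists_notMem_of_finite_of_ne_top hfin (by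
    rintro (⟨S, hS, h⟩ | h)
    · exact vectorSpan_ne_top_of_card_le S (by simp) (by simpa using hS.2) h
    · simp only [Set.mem_iUnion] at h
      obtain ⟨S, hS, v, hv, h⟩ := h
      obtain ⟨w, hw, hwv⟩ := Finset.exists_mem_ne (s := S) (by have := hS.2; omega) v
      have h1 := (c S v).apply_add_smul w (v - w) 1
      have h2 : (c S v).linear (v - w) = 0 := by
        rw [← LinearMap.mem_ker]
        exact (show LinearMap.ker (c S v).linear = ⊤ from h) ▸ Submodule.mem_top
      rw [one_smul, add_sub_cancel, h2, (hc S hS.1 v hv).1, (hc S hS.1 v hv).2 w hw hwv.symm] at h1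
      norm_num at h1)
  refine ⟨q, fun S hS hS3 => hq _ (Or.inl ⟨S, ⟨hS, hS3⟩, rfl⟩), fun S hS hS4 v hv h => ?_⟩
  refine hq (LinearMap.ker (c S v).linear) (Or.inr ?_) (LinearMap.mem_ker.2 h)
  exact Set.mem_biUnion (show S ∈ {S | S ∈ T ∧ S.card = 4} from ⟨hS, hS4⟩) ⟨v, hv, rfl⟩

/-- Each face through `p` is counted once by the sign patterns of a generic direction. -/
lemma IsTriangulationOf.ncard_faces (hT : IsTriangulationOf P T) (hp : P ∈ 𝓝 p)
    (hpT : {p} ∈ T) (hcent : IsCentral p T)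
    {c : Finset (Fin 3 → ℝ) → (Fin 3 → ℝ) → (Fin 3 → ℝ) →ᵃ[ℝ] ℝ}
    (hc : ∀ S ∈ T, IsCoords S (c S))
    (hc4 : ∀ S ∈ T, S.card = 4 → ∀ x, (∀ v ∈ S, 0 ≤ c S v x) →
      x ∈ convexHull ℝ (S : Set (Fin 3 → ℝ)))
    {q : Fin 3 → ℝ} (hq : ∀ S ∈ T, S.card ≤ 3 → q ∉ vectorSpan ℝ (S : Set (Fin 3 → ℝ)))
    (hqc : ∀ S ∈ T, S.card = 4 → ∀ v ∈ S, (c S v).linear q ≠ 0)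
    {C : Finset (Finset (Fin 3 → ℝ))} (hC : ∀ S, S ∈ C ↔ S ∈ T ∧ S.card = 4)
    (k j : ℕ) (hkj : k + j = 4) :
    {S | S ∈ T ∧ S.card = k ∧ p ∈ convexHull ℝ (S : Set (Fin 3 → ℝ))}.ncard =
      ∑ S ∈ C, ((S.erase p).filter fun v => 0 < (c S v).linear q).card.choose j := by
  classical
  have hpmem : ∀ S ∈ T, (p ∈ convexHull ℝ (S : Set (Fin 3 → ℝ)) ↔ p ∈ S) := fun S hS =>
    ⟨hT.mem_of_mem_convexHull hpT (Finset.mem_singleton_self p) hS,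
      fun h => subset_convexHull ℝ _ h⟩
  have hset : {S | S ∈ T ∧ S.card = k ∧ p ∈ convexHull ℝ (S : Set (Fin 3 → ℝ))} =
      ↑(hT.1.toFinset.filter fun S => p ∈ S ∧ S.card = k) := by
    ext S
    simp only [Set.mem_ofPred_eq, Finset.coe_filter, Set.Finite.mem_toFinset]
    exact and_congr_right fun hS => by rw [hpmem S hS, and_comm]
  rw [hset, Set.ncard_coe_finset]
  refine card_faces_eq_sum_choose C _ p _ k j (fun S _ => Finset.filter_subset _ _) ?_ ?_ ?_ ?_ ?_
  · intro S hS
    obtain ⟨hS, hS4⟩ := (hC S).1 hS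
    exact (hpmem S hS).1 (hcent S hS hS4)
  · intro S hS
    rw [((hC S).1 hS).2, hkj]
  · intro S hS F hFS hpF hF
    simp only [Finset.mem_filter, Set.Finite.mem_toFinset]
    exact ⟨hT.2.2.2.1 S ((hC S).1 hS).1 F hFS, hpF, hF⟩
  · intro F hF
    exact (Finset.mem_filter.1 hF).2
  · intro F hF
    simp only [Finset.mem_filter, Set.Finite.mem_toFinset] at hF
    obtain ⟨hF, hpF, -⟩ := hF
    refine (existsUnique_congr fun S => ?_).1 (hT.existsUnique_tetrahedron hp hc hc4 hq hqc hF hpF)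
    rw [hC]
    refine and_congr_right fun _ => and_congr_right fun hFS => ?_
    simp only [Finset.subset_iff, Finset.mem_sdiff, Finset.mem_filter, Finset.mem_erase]
    refine ⟨fun h v hv => ⟨⟨?_, hv.1⟩, h v hv.1 hv.2⟩, fun h v hv hvF => (h ⟨hv, hvF⟩).2⟩
    rintro rfl
    exact hv.2 hpF

end Triangulation

theorem stmt11 (P : Set (Fin 3 → ℝ)) (p : Fin 3 → ℝ)
    (hP : IsCanonicalPoly P p) (hrefl : IsReflexive P p)
    (T : Set (Finset (Fin 3 → ℝ))) (hT : IsTriangulationOf P T)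
    (hfine : IsFine P T) (hcent : IsCentral p T) (huni : IsUnimodular T)
    (V : ℕ) (hV : volume P * 6 = (V : ENNReal)) :
    {S | S ∈ T ∧ S.card = 4}.ncard = V ∧
    2 * {S | S ∈ T ∧ S.card = 3 ∧ p ∈ convexHull ℝ (S : Set (Fin 3 → ℝ))}.ncard = 3 * V ∧
    2 * {S | S ∈ T ∧ S.card = 2 ∧ p ∈ convexHull ℝ (S : Set (Fin 3 → ℝ))}.ncard = V + 4 := by
  classical
  have hpP : p ∈ interior P := (hP.2.2.symm ▸ Set.mem_singleton p : p ∈ interior P ∩ latticePts).1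
  have hnhds : P ∈ nhds p := mem_interior_iff_mem_nhds.1 hpP
  have hpT : {p} ∈ T := by
    obtain ⟨S, hS, hpS⟩ := hfine p ⟨interior_subset hpP, hP.2.1⟩
    exact hT.2.2.2.1 S hS _ (by simpa using hpS)
  have hN := hT.ncard_tetrahedra huni hV
  choose! c hc hc4 using fun S (hS : S ∈ T) => exists_isCoords S (hT.2.1 S hS).2
  simp only [Module.finrank_fin_fun, Nat.reduceAdd] at hc4
  obtain ⟨q, hq, hqc⟩ := hT.exists_generic hc
  set C := hT.1.toFinset.filter fun S => S.card = 4 with hCdef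
  have hC : ∀ S, S ∈ C ↔ S ∈ T ∧ S.card = 4 := fun S => by simp [hCdef]
  have hCV : C.card = V := by
    rw [← hN, ← Set.ncard_coe_finset]
    congr 1
    ext S
    simp [hC]
  have hpos := hT.ncard_faces hnhds hpT hcent hc hc4 hq hqc hC
  have hneg := hT.ncard_faces (q := -q) hnhds hpT hcent hc hc4
    (fun S hS h => by simpa using hq S hS h) (fun S hS h v hv => by simpa using hqc S hS h v hv) hC
  set a : Finset (Fin 3 → ℝ) → ℕ :=
    fun S => ((S.erase p).filter fun v => 0 < (c S v).linear q).card with ha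
  set b : Finset (Fin 3 → ℝ) → ℕ :=
    fun S => ((S.erase p).filter fun v => 0 < (c S v).linear (-q)).card with hb
  have hab : ∀ S ∈ C, a S + b S = 3 := by
    intro S hS
    obtain ⟨hS, hS4⟩ := (hC S).1 hS
    have hpS := hT.mem_of_mem_convexHull hpT (Finset.mem_singleton_self p) hS (hcent S hS hS4)
    have hcongr : ((S.erase p).filter fun v => 0 < (c S v).linear (-q)) =
        (S.erase p).filter fun v => ¬ 0 < (c S v).linear q := by
      refine Finset.filter_congr fun v hv => ?_
      have := hqc S hS hS4 v (Finset.mem_of_mem_erase hv)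
      rw [map_neg, neg_pos, not_lt]
      exact ⟨le_of_lt, fun h => lt_of_le_of_ne h this⟩
    rw [ha, hb]
    simp only [hcongr]
    rw [Finset.card_filter_add_card_filter_not, Finset.card_erase_of_mem hpS, hS4]
  have hone : {S | S ∈ T ∧ S.card = 1 ∧ p ∈ convexHull ℝ (S : Set (Fin 3 → ℝ))}.ncard = 1 := by
    rw [Set.ncard_eq_one]
    refine ⟨{p}, Set.ext fun S => ?_⟩
    rw [Set.mem_ofPred_eq, Set.mem_singleton_iff]
    constructor
    · rintro ⟨hS, h1, hpS⟩
      obtain ⟨x, rfl⟩ := Finset.card_eq_one.1 h1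
      simpa [eq_comm] using hpS
    · rintro rfl
      exact ⟨hpT, by simp, by simp⟩
  have hchoose : ∀ m n : ℕ, m + n = 3 → m.choose 2 + n.choose 2 =
      1 + 2 * (m.choose 3 + n.choose 3) := by
    intro m n h
    obtain rfl : n = 3 - m := by omega
    have : m ≤ 3 := by omega
    interval_cases m <;> rfl
  refine ⟨hN, ?_, ?_⟩
  · have h : ∑ S ∈ C, ((a S).choose 1 + (b S).choose 1) = ∑ _S ∈ C, 3 :=
      Finset.sum_congr rfl fun S hS => by rw [Nat.choose_one_right, Nat.choose_one_right, hab S hS]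
    rw [Finset.sum_add_distrib, ← hpos 3 1 rfl, ← hneg 3 1 rfl, Finset.sum_const, hCV,
      smul_eq_mul] at h
    omega
  · have h : ∑ S ∈ C, ((a S).choose 2 + (b S).choose 2) =
        ∑ S ∈ C, (1 + 2 * ((a S).choose 3 + (b S).choose 3)) :=
      Finset.sum_congr rfl fun S hS => hchoose _ _ (hab S hS)
    rw [Finset.sum_add_distrib, Finset.sum_add_distrib, ← Finset.mul_sum, Finset.sum_add_distrib,
      ← hpos 2 2 rfl, ← hneg 2 2 rfl, ← hpos 1 3 rfl, ← hneg 1 3 rfl, hone, Finset.sum_const,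
      hCV, smul_eq_mul] at h
    omega
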